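/- arXiv:1001.5000 — 8 statements merged into one kernel-verified Lean document; each statement's English description precedes it below -/
import Mathlib

section
/- Let (A, μ, Δ, α) be a finite-dimensional infinitesimal Hom-bialgebra. Then (A*, Δ*, μ*, α*) is an infinitesimal Hom-bialgebra, where A* = Hom(A,k), α*(φ) = φ∘α, the multiplication Δ* : A*⊗A* → A* is defined by ⟨Δ*(φ⊗ψ), a⟩ = ⟨φ⊗ψ, Δ(a)⟩, and the comultiplication μ* : A* → A*⊗A* is defined (via the canonical isomorphism (A⊗A)* ≅ A*⊗A* in finite dimensions) by ⟨μ*(φ), a⊗b⟩ = ⟨φ, μ(a⊗b)⟩. -/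
open TensorProduct

noncomputable section

variable {k : Type*} [Field k] {A : Type*} [AddCommGroup A] [Module k A]

/-- `(A, μ, α)` is a Hom-associative algebra: multiplicativity and Hom-associativity. -/
def IsHomAssociative (μ : A ⊗[k] A →ₗ[k] A) (α : A →ₗ[k] A) : Prop :=
  (∀ x y : A, α (μ (x ⊗ₜ y)) = μ (α x ⊗ₜ α y)) ∧
  (∀ x y z : A, μ (α x ⊗ₜ μ (y ⊗ₜ z)) = μ (μ (x ⊗ₜ y) ⊗ₜ α z))

/-- `(A, Δ, α)` is a Hom-coassociative coalgebra: comultiplicativity and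
Hom-coassociativity (the latter via the associator). -/
def IsHomCoassociative (Δ : A →ₗ[k] A ⊗[k] A) (α : A →ₗ[k] A) : Prop :=
  (∀ a : A, Δ (α a) = TensorProduct.map α α (Δ a)) ∧
  (∀ a : A, TensorProduct.map α Δ (Δ a)
      = TensorProduct.assoc k A A A (TensorProduct.map Δ α (Δ a)))

/-- The cocycle condition `Δ∘μ = (μ⊗α)∘(α⊗Δ) + (α⊗μ)∘(Δ⊗α)`. -/
def IsCocycle (μ : A ⊗[k] A →ₗ[k] A) (Δ : A →ₗ[k] A ⊗[k] A) (α : A →ₗ[k] A) : Prop :=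
  ∀ a b : A,
    Δ (μ (a ⊗ₜ b)) =
      TensorProduct.map μ α ((TensorProduct.assoc k A A A).symm (α a ⊗ₜ Δ b)) +
      TensorProduct.map α μ (TensorProduct.assoc k A A A (Δ a ⊗ₜ α b))

/-- Infinitesimal Hom-bialgebra. -/
def IsInfHomBialgebra (μ : A ⊗[k] A →ₗ[k] A) (Δ : A →ₗ[k] A ⊗[k] A)
    (α : A →ₗ[k] A) : Prop :=
  IsHomAssociative μ α ∧ IsHomCoassociative Δ α ∧ IsCocycle μ Δ α

/-- `[a, -]_*` : sends `Σ b₁⊗b₂` to `Σ μ(a,b₁)⊗α(b₂) − α(b₁)⊗μ(b₂,a)`. -/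
def starBracket (μ : A ⊗[k] A →ₗ[k] A) (α : A →ₗ[k] A) (a : A) :
    A ⊗[k] A →ₗ[k] A ⊗[k] A :=
  TensorProduct.map (μ ∘ₗ TensorProduct.mk k A A a) α
    - TensorProduct.map α (μ ∘ₗ (TensorProduct.mk k A A).flip a)

/-- Coboundary infinitesimal Hom-bialgebra: an infinitesimal Hom-bialgebra with an
`α`-invariant `r` such that `Δ = [-, r]_*`. -/
def IsCoboundary (μ : A ⊗[k] A →ₗ[k] A) (Δ : A →ₗ[k] A ⊗[k] A) (α : A →ₗ[k] A)
    (r : A ⊗[k] A) : Prop :=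
  IsInfHomBialgebra μ Δ α ∧ TensorProduct.map α α r = r ∧
    ∀ a : A, Δ a = starBracket μ α a r

/-- `[a, -]_•` on 2-tensors: `Σ μ(α(a),b₁)⊗α(b₂) − α(b₁)⊗μ(b₂,α(a))`. -/
def dotBracket2 (μ : A ⊗[k] A →ₗ[k] A) (α : A →ₗ[k] A) (a : A) :
    A ⊗[k] A →ₗ[k] A ⊗[k] A :=
  TensorProduct.map (μ ∘ₗ TensorProduct.mk k A A (α a)) α
    - TensorProduct.map α (μ ∘ₗ (TensorProduct.mk k A A).flip (α a))

/-- `[a, -]_•` on 3-tensors: `Σ μ(α(a),b₁)⊗α(b₂)⊗α(b₃) − α(b₁)⊗α(b₂)⊗μ(b₃,α(a))`. -/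
def dotBracket3 (μ : A ⊗[k] A →ₗ[k] A) (α : A →ₗ[k] A) (a : A) :
    A ⊗[k] (A ⊗[k] A) →ₗ[k] A ⊗[k] (A ⊗[k] A) :=
  TensorProduct.map (μ ∘ₗ TensorProduct.mk k A A (α a)) (TensorProduct.map α α)
    - TensorProduct.map α
        (TensorProduct.map α (μ ∘ₗ (TensorProduct.mk k A A).flip (α a)))

/-- `(r, s) ↦ r₁₃s₁₂ = Σ μ(uᵢ,uⱼ')⊗α(vⱼ')⊗α(vᵢ)` for `r = Σ uᵢ⊗vᵢ`, `s = Σ uⱼ'⊗vⱼ'`. -/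
def t13_12 (μ : A ⊗[k] A →ₗ[k] A) (α : A →ₗ[k] A) :
    (A ⊗[k] A) ⊗[k] (A ⊗[k] A) →ₗ[k] A ⊗[k] (A ⊗[k] A) :=
  TensorProduct.map μ
      (TensorProduct.map α α ∘ₗ (TensorProduct.comm k A A).toLinearMap)
    ∘ₗ (TensorProduct.tensorTensorTensorComm k A A A A).toLinearMap

/-- `(r, s) ↦ r₁₂s₂₃ = Σ α(uᵢ)⊗μ(vᵢ,uⱼ')⊗α(vⱼ')`. -/
def t12_23 (μ : A ⊗[k] A →ₗ[k] A) (α : A →ₗ[k] A) :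
    (A ⊗[k] A) ⊗[k] (A ⊗[k] A) →ₗ[k] A ⊗[k] (A ⊗[k] A) :=
  TensorProduct.map α
      (TensorProduct.map μ α ∘ₗ (TensorProduct.assoc k A A A).symm.toLinearMap)
    ∘ₗ (TensorProduct.assoc k A A (A ⊗[k] A)).toLinearMap

/-- `(r, s) ↦ r₂₃s₁₃ = Σ α(uⱼ')⊗α(uᵢ)⊗μ(vᵢ,vⱼ')`. -/
def t23_13 (μ : A ⊗[k] A →ₗ[k] A) (α : A →ₗ[k] A) :
    (A ⊗[k] A) ⊗[k] (A ⊗[k] A) →ₗ[k] A ⊗[k] (A ⊗[k] A) :=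
  (TensorProduct.assoc k A A A).toLinearMap
    ∘ₗ TensorProduct.map
        (TensorProduct.map α α ∘ₗ (TensorProduct.comm k A A).toLinearMap) μ
    ∘ₗ (TensorProduct.tensorTensorTensorComm k A A A A).toLinearMap

/-- `A(r) = r₁₃r₁₂ − r₁₂r₂₃ + r₂₃r₁₃`. -/
def Atensor (μ : A ⊗[k] A →ₗ[k] A) (α : A →ₗ[k] A) (r : A ⊗[k] A) :
    A ⊗[k] (A ⊗[k] A) :=
  t13_12 μ α (r ⊗ₜ r) - t12_23 μ α (r ⊗ₜ r) + t23_13 μ α (r ⊗ₜ r)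

/-- Quasi-triangular infinitesimal Hom-bialgebra: coboundary with `A(r) = 0`. -/
def IsQuasiTriangular (μ : A ⊗[k] A →ₗ[k] A) (Δ : A →ₗ[k] A ⊗[k] A) (α : A →ₗ[k] A)
    (r : A ⊗[k] A) : Prop :=
  IsCoboundary μ Δ α r ∧ Atensor μ α r = 0

/-- The balanceator `B(x,y) = [x, Δᵒᵖ(y)]_• + τ([y, Δᵒᵖ(x)]_•)`. -/
def balanceator (μ : A ⊗[k] A →ₗ[k] A) (Δ : A →ₗ[k] A ⊗[k] A) (α : A →ₗ[k] A)
    (x y : A) : A ⊗[k] A :=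
  dotBracket2 μ α x (TensorProduct.comm k A A (Δ y))
    + TensorProduct.comm k A A (dotBracket2 μ α y (TensorProduct.comm k A A (Δ x)))

/-- `ad_x` on 2-tensors, for a bilinear bracket `br`:
`y₁⊗y₂ ↦ [x,y₁]⊗α(y₂) + α(y₁)⊗[x,y₂]`. -/
def adMap (br : A →ₗ[k] A →ₗ[k] A) (α : A →ₗ[k] A) (x : A) :
    A ⊗[k] A →ₗ[k] A ⊗[k] A :=
  TensorProduct.map (br x) α + TensorProduct.map α (br x)

/-- Cyclic rotation on triple tensors: `x⊗y⊗z ↦ y⊗z⊗x`. -/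
def cyc3 : A ⊗[k] (A ⊗[k] A) →ₗ[k] A ⊗[k] (A ⊗[k] A) :=
  (TensorProduct.assoc k A A A).toLinearMap
    ∘ₗ (TensorProduct.comm k A (A ⊗[k] A)).toLinearMap

/-- Hom-Lie bialgebra: Hom-Lie algebra, Hom-Lie coalgebra, and the cocycle
compatibility `δ([x,y]) = ad_{α(x)}(δ(y)) − ad_{α(y)}(δ(x))`. -/
def IsHomLieBialgebra (br : A →ₗ[k] A →ₗ[k] A) (δ : A →ₗ[k] A ⊗[k] A)
    (α : A →ₗ[k] A) : Prop :=
  (∀ x y : A, br x y = - br y x) ∧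
  (∀ x y : A, α (br x y) = br (α x) (α y)) ∧
  (∀ x y z : A, br (br x y) (α z) + br (br z x) (α y) + br (br y z) (α x) = 0) ∧
  (∀ x : A, δ (α x) = TensorProduct.map α α (δ x)) ∧
  (∀ x : A, TensorProduct.comm k A A (δ x) = - δ x) ∧
  (∀ x : A, TensorProduct.map α δ (δ x) + cyc3 (TensorProduct.map α δ (δ x))
      + cyc3 (cyc3 (TensorProduct.map α δ (δ x))) = 0) ∧
  (∀ x y : A, δ (br x y) = adMap br α (α x) (δ y) - adMap br α (α y) (δ x))

/-- The commutator bracket of `μ`, as a bilinear map. -/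
def commBracket (μ : A ⊗[k] A →ₗ[k] A) : A →ₗ[k] A →ₗ[k] A :=
  TensorProduct.curry μ - (TensorProduct.curry μ).flip

/-- The cocommutator cobracket `(Id − τ)∘Δ`. -/
def cobracket (Δ : A →ₗ[k] A ⊗[k] A) : A →ₗ[k] A ⊗[k] A :=
  Δ - (TensorProduct.comm k A A).toLinearMap ∘ₗ Δ

/-- `(r, s) ↦ [r₁₂, s₁₃] = Σ β(uᵢ⊗uⱼ')⊗α(vᵢ)⊗α(vⱼ')` for a bracket `β`. -/
def c12_13 (β : A ⊗[k] A →ₗ[k] A) (α : A →ₗ[k] A) :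
    (A ⊗[k] A) ⊗[k] (A ⊗[k] A) →ₗ[k] A ⊗[k] (A ⊗[k] A) :=
  TensorProduct.map β (TensorProduct.map α α)
    ∘ₗ (TensorProduct.tensorTensorTensorComm k A A A A).toLinearMap

/-- `(r, s) ↦ [r₁₂, s₂₃] = Σ α(uᵢ)⊗β(vᵢ⊗uⱼ')⊗α(vⱼ')`. -/
def c12_23 (β : A ⊗[k] A →ₗ[k] A) (α : A →ₗ[k] A) :
    (A ⊗[k] A) ⊗[k] (A ⊗[k] A) →ₗ[k] A ⊗[k] (A ⊗[k] A) :=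
  TensorProduct.map α
      (TensorProduct.map β α ∘ₗ (TensorProduct.assoc k A A A).symm.toLinearMap)
    ∘ₗ (TensorProduct.assoc k A A (A ⊗[k] A)).toLinearMap

/-- `(r, s) ↦ [r₁₃, s₂₃] = Σ α(uᵢ)⊗α(uⱼ')⊗β(vᵢ⊗vⱼ')`. -/
def c13_23 (β : A ⊗[k] A →ₗ[k] A) (α : A →ₗ[k] A) :
    (A ⊗[k] A) ⊗[k] (A ⊗[k] A) →ₗ[k] A ⊗[k] (A ⊗[k] A) :=
  (TensorProduct.assoc k A A A).toLinearMap
    ∘ₗ TensorProduct.map (TensorProduct.map α α) β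
    ∘ₗ (TensorProduct.tensorTensorTensorComm k A A A A).toLinearMap

/-- `C(r) = [r₁₂,r₁₃] + [r₁₂,r₂₃] + [r₁₃,r₂₃]` for a bracket `β`. -/
def Ctensor (β : A ⊗[k] A →ₗ[k] A) (α : A →ₗ[k] A) (r : A ⊗[k] A) :
    A ⊗[k] (A ⊗[k] A) :=
  c12_13 β α (r ⊗ₜ r) + c12_23 β α (r ⊗ₜ r) + c13_23 β α (r ⊗ₜ r)

section Pairing

variable {M N P M' N' X Y : Type*} [AddCommMonoid M] [Module k M] [AddCommMonoid N] [Module k N]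
  [AddCommMonoid P] [Module k P] [AddCommMonoid M'] [Module k M'] [AddCommMonoid N'] [Module k N']
  [AddCommMonoid X] [Module k X] [AddCommMonoid Y] [Module k Y]

/-- If `F` and `G` are the families of functionals `p`, `q` precomposed with `f`, `g`, then
`F ⊗ G` is `p ⊗ q` precomposed with `f ⊗ g`. -/
theorem dualDistrib_map_apply {f : M →ₗ[k] M'} {g : N →ₗ[k] N'}
    {p : X →ₗ[k] Module.Dual k M'} {q : Y →ₗ[k] Module.Dual k N'}
    {F : X →ₗ[k] Module.Dual k M} {G : Y →ₗ[k] Module.Dual k N}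
    (hF : ∀ x m, F x m = p x (f m)) (hG : ∀ y n, G y n = q y (g n))
    (w : X ⊗[k] Y) (z : M ⊗[k] N) :
    dualDistrib k M N (TensorProduct.map F G w) z =
      dualDistrib k M' N' (TensorProduct.map p q w) (TensorProduct.map f g z) := by
  induction w with
  | zero => simp
  | add w₁ w₂ h₁ h₂ => simp only [map_add, LinearMap.add_apply, h₁, h₂]
  | tmul x y =>
    induction z with
    | zero => simp
    | add z₁ z₂ h₁ h₂ => simp only [map_add, h₁, h₂]
    | tmul m n => simp [hF, hG]

theorem dualDistrib_map_apply_eq_apply_map {f : M →ₗ[k] M'} {g : N →ₗ[k] N'}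
    {F : Module.Dual k M' →ₗ[k] Module.Dual k M} {G : Module.Dual k N' →ₗ[k] Module.Dual k N}
    (hF : ∀ φ m, F φ m = φ (f m)) (hG : ∀ ψ n, G ψ n = ψ (g n))
    (w : Module.Dual k M' ⊗[k] Module.Dual k N') (z : M ⊗[k] N) :
    dualDistrib k M N (TensorProduct.map F G w) z =
      dualDistrib k M' N' w (TensorProduct.map f g z) := by
  rw [dualDistrib_map_apply (p := LinearMap.id) (q := LinearMap.id) hF hG, TensorProduct.map_id,
    LinearMap.id_apply]

/-- The canonical pairing of triple tensor products is compatible with the associators. -/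
theorem dualDistrib_assoc_apply
    (w : (Module.Dual k M ⊗[k] Module.Dual k N) ⊗[k] Module.Dual k P) (z : (M ⊗[k] N) ⊗[k] P) :
    dualDistrib k M (N ⊗[k] P)
        (TensorProduct.map LinearMap.id (dualDistrib k N P) (TensorProduct.assoc k _ _ _ w))
        (TensorProduct.assoc k M N P z) =
      dualDistrib k (M ⊗[k] N) P
        (TensorProduct.map (dualDistrib k M N) LinearMap.id w) z := by
  induction w with
  | zero => simp
  | add w₁ w₂ h₁ h₂ => simp only [map_add, LinearMap.add_apply, h₁, h₂]
  | tmul x χ =>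
    induction x with
    | zero => simp
    | add x₁ x₂ h₁ h₂ => simp only [map_add, add_tmul, LinearMap.add_apply, h₁, h₂]
    | tmul φ ψ =>
      induction z with
      | zero => simp
      | add z₁ z₂ h₁ h₂ => simp only [map_add, h₁, h₂]
      | tmul y p =>
        induction y with
        | zero => simp
        | add y₁ y₂ h₁ h₂ => simp only [map_add, add_tmul, h₁, h₂]
        | tmul m n => simp [mul_assoc]

end Pairing

section Injective

variable {M N P : Type*} [AddCommGroup M] [Module k M] [AddCommGroup N] [Module k N]
  [AddCommGroup P] [Module k P]

theorem dualDistrib_injective [FiniteDimensional k M] [FiniteDimensional k N] :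
    Function.Injective (dualDistrib k M N) :=
  (dualDistribEquiv k M N).injective

/-- Elements of `M* ⊗ (N* ⊗ P*)` are determined by their pairing with `M ⊗ (N ⊗ P)`. -/
theorem dualDistrib_map_id_dualDistrib_injective
    [FiniteDimensional k M] [FiniteDimensional k N] [FiniteDimensional k P] :
    Function.Injective fun w : Module.Dual k M ⊗[k] (Module.Dual k N ⊗[k] Module.Dual k P) =>
      dualDistrib k M (N ⊗[k] P) (TensorProduct.map LinearMap.id (dualDistrib k N P) w) :=
  dualDistrib_injective.comp
    (TensorProduct.congr (LinearEquiv.refl k _) (dualDistribEquiv k N P)).injective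

end Injective

/-- the dual of a finite-dimensional infinitesimal Hom-bialgebra is an
infinitesimal Hom-bialgebra `(A*, Δ*, μ*, α*)`. -/
theorem stmt1 [CharZero k] [FiniteDimensional k A]
    (μ : A ⊗[k] A →ₗ[k] A) (Δ : A →ₗ[k] A ⊗[k] A) (α : A →ₗ[k] A)
    (h : IsInfHomBialgebra μ Δ α)
    (Δs : Module.Dual k A ⊗[k] Module.Dual k A →ₗ[k] Module.Dual k A)
    (μs : Module.Dual k A →ₗ[k] Module.Dual k A ⊗[k] Module.Dual k A)
    (αs : Module.Dual k A →ₗ[k] Module.Dual k A)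
    (hαs : ∀ (φ : Module.Dual k A) (a : A), αs φ a = φ (α a))
    (hΔs : ∀ (φ ψ : Module.Dual k A) (a : A),
      Δs (φ ⊗ₜ ψ) a = TensorProduct.dualDistrib k A A (φ ⊗ₜ ψ) (Δ a))
    (hμs : ∀ (φ : Module.Dual k A) (a b : A),
      TensorProduct.dualDistrib k A A (μs φ) (a ⊗ₜ b) = φ (μ (a ⊗ₜ b))) :
    IsInfHomBialgebra Δs μs αs := by
  obtain ⟨⟨hαμ, hμ⟩, ⟨hαΔ, hΔ⟩, hc⟩ := h
  have hΔs' (w : Module.Dual k A ⊗[k] Module.Dual k A) (a : A) :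
      Δs w a = dualDistrib k A A w (Δ a) := by
    induction w with
    | zero => simp
    | add w₁ w₂ h₁ h₂ => simp only [map_add, LinearMap.add_apply, h₁, h₂]
    | tmul φ ψ => exact hΔs φ ψ a
  have hμs' (φ : Module.Dual k A) (z : A ⊗[k] A) : dualDistrib k A A (μs φ) z = φ (μ z) := by
    induction z with
    | zero => simp
    | add z₁ z₂ h₁ h₂ => simp only [map_add, h₁, h₂]
    | tmul a b => exact hμs φ a b
  have hαα (w : Module.Dual k A ⊗[k] Module.Dual k A) (z : A ⊗[k] A) :
      dualDistrib k A A (TensorProduct.map αs αs w) z =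
        dualDistrib k A A w (TensorProduct.map α α z) :=
    dualDistrib_map_apply_eq_apply_map hαs hαs w z
  have hαΔs (w : Module.Dual k A ⊗[k] (Module.Dual k A ⊗[k] Module.Dual k A)) (z : A ⊗[k] A) :
      dualDistrib k A A (TensorProduct.map αs Δs w) z =
        dualDistrib k A (A ⊗[k] A)
          (TensorProduct.map LinearMap.id (dualDistrib k A A) w) (TensorProduct.map α Δ z) :=
    dualDistrib_map_apply (p := LinearMap.id) (q := dualDistrib k A A) hαs hΔs' w z
  have hΔαs (w : (Module.Dual k A ⊗[k] Module.Dual k A) ⊗[k] Module.Dual k A) (z : A ⊗[k] A) :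
      dualDistrib k A A (TensorProduct.map Δs αs w) z =
        dualDistrib k (A ⊗[k] A) A
          (TensorProduct.map (dualDistrib k A A) LinearMap.id w) (TensorProduct.map Δ α z) :=
    dualDistrib_map_apply (p := dualDistrib k A A) (q := LinearMap.id) hΔs' hαs w z
  have hαμs (w : Module.Dual k A ⊗[k] Module.Dual k A) (z : A ⊗[k] (A ⊗[k] A)) :
      dualDistrib k A (A ⊗[k] A) (TensorProduct.map LinearMap.id (dualDistrib k A A)
          (TensorProduct.map αs μs w)) z =
        dualDistrib k A A w (TensorProduct.map α μ z) := by
    rw [TensorProduct.map_map]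
    exact dualDistrib_map_apply_eq_apply_map hαs hμs' w z
  have hμαs (w : Module.Dual k A ⊗[k] Module.Dual k A) (z : (A ⊗[k] A) ⊗[k] A) :
      dualDistrib k (A ⊗[k] A) A (TensorProduct.map (dualDistrib k A A) LinearMap.id
          (TensorProduct.map μs αs w)) z =
        dualDistrib k A A w (TensorProduct.map μ α z) := by
    rw [TensorProduct.map_map]
    exact dualDistrib_map_apply_eq_apply_map hμs' hαs w z
  refine ⟨⟨fun φ ψ => ?_, fun φ ψ χ => ?_⟩, ⟨fun φ => ?_, fun φ => ?_⟩, fun φ ψ => ?_⟩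
  · ext a
    rw [hαs, hΔs', hΔs', hαΔ, ← hαα, TensorProduct.map_tmul]
  · ext a
    rw [hΔs', hΔs', ← TensorProduct.map_tmul, ← TensorProduct.map_tmul, hαΔs, hΔαs, hΔ,
      ← dualDistrib_assoc_apply, TensorProduct.assoc_tmul]
  · apply dualDistrib_injective
    ext a b
    change dualDistrib k A A _ (a ⊗ₜ b) = dualDistrib k A A _ (a ⊗ₜ b)
    rw [hμs', hαs, hαμ, hαα, TensorProduct.map_tmul, hμs']
  · apply dualDistrib_map_id_dualDistrib_injective
    ext a b c
    change dualDistrib k A (A ⊗[k] A) _ (a ⊗ₜ (b ⊗ₜ c)) =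
      dualDistrib k A (A ⊗[k] A) _ (a ⊗ₜ (b ⊗ₜ c))
    rw [hαμs, ← TensorProduct.assoc_tmul, dualDistrib_assoc_apply, hμαs,
      TensorProduct.assoc_tmul, TensorProduct.map_tmul, TensorProduct.map_tmul, hμs', hμs', hμ]
  · apply dualDistrib_injective
    ext a b
    change dualDistrib k A A _ (a ⊗ₜ b) = dualDistrib k A A _ (a ⊗ₜ b)
    have hl : dualDistrib k A A (TensorProduct.map Δs αs
        ((TensorProduct.assoc k _ _ _).symm (αs φ ⊗ₜ μs ψ))) (a ⊗ₜ b) =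
        dualDistrib k A A (φ ⊗ₜ ψ)
          (TensorProduct.map α μ (TensorProduct.assoc k A A A (Δ a ⊗ₜ α b))) := by
      rw [hΔαs, ← dualDistrib_assoc_apply, LinearEquiv.apply_symm_apply,
        ← TensorProduct.map_tmul αs μs, hαμs, TensorProduct.map_tmul Δ α]
    have hr : dualDistrib k A A (TensorProduct.map αs Δs
        (TensorProduct.assoc k _ _ _ (μs φ ⊗ₜ αs ψ))) (a ⊗ₜ b) =
        dualDistrib k A A (φ ⊗ₜ ψ)
          (TensorProduct.map μ α ((TensorProduct.assoc k A A A).symm (α a ⊗ₜ Δ b))) := by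
      rw [hαΔs, TensorProduct.map_tmul α Δ,
        ← (TensorProduct.assoc k A A A).apply_symm_apply (α a ⊗ₜ Δ b), dualDistrib_assoc_apply,
        ← TensorProduct.map_tmul μs αs, hμαs, LinearEquiv.apply_symm_apply]
    rw [hμs', hΔs', hc, map_add, map_add, LinearMap.add_apply, hl, hr, add_comm]

end
end

section
/- Let (A, μ, Δ, α) be an infinitesimal Hom-bialgebra. Then for each integer n ≥ 0, the quadruple Aⁿ = (A, μ⁽ⁿ⁾, Δ⁽ⁿ⁾, α^{2ⁿ}) is an infinitesimal Hom-bialgebra, where μ⁽ⁿ⁾ = α^{2ⁿ−1}∘μ and Δ⁽ⁿ⁾ = Δ∘α^{2ⁿ−1}. -/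
open TensorProduct

noncomputable section

variable {k : Type*} [Field k] {A : Type*} [AddCommGroup A] [Module k A]

theorem IsHomAssociative.twist {μ : A ⊗[k] A →ₗ[k] A} {α β : A →ₗ[k] A}
    (h : IsHomAssociative μ α) (hβα : ∀ x, β (α x) = α (β x))
    (hβμ : ∀ x y, β (μ (x ⊗ₜ y)) = μ (β x ⊗ₜ β y)) :
    IsHomAssociative (β ∘ₗ μ) (β ∘ₗ α) := by
  refine ⟨fun x y => ?_, fun x y z => ?_⟩
  · simp only [LinearMap.comp_apply, ← hβμ, ← h.1, hβα]
  · simp only [LinearMap.comp_apply, ← hβμ, h.2]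

theorem IsHomCoassociative.twist {Δ : A →ₗ[k] A ⊗[k] A} {α β : A →ₗ[k] A}
    (h : IsHomCoassociative Δ α) (hβα : ∀ x, β (α x) = α (β x))
    (hβΔ : ∀ a, Δ (β a) = TensorProduct.map β β (Δ a)) :
    IsHomCoassociative (Δ ∘ₗ β) (β ∘ₗ α) := by
  have hΔβ : Δ ∘ₗ β = TensorProduct.map β β ∘ₗ Δ := LinearMap.ext hβΔ
  refine ⟨fun a => ?_, fun a => ?_⟩
  · rw [TensorProduct.map_comp]
    simp only [LinearMap.comp_apply, ← h.1, ← hβΔ]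
    rw [hβα]
  · rw [LinearMap.comp_apply, hΔβ, TensorProduct.map_comp, TensorProduct.map_comp,
      LinearMap.comp_apply, LinearMap.comp_apply, h.2, TensorProduct.map_map_assoc]

theorem IsCocycle.twist {μ : A ⊗[k] A →ₗ[k] A} {Δ : A →ₗ[k] A ⊗[k] A} {α β : A →ₗ[k] A}
    (h : IsCocycle μ Δ α) (hβα : ∀ x, β (α x) = α (β x))
    (hβμ : ∀ x y, β (μ (x ⊗ₜ y)) = μ (β x ⊗ₜ β y))
    (hβΔ : ∀ a, Δ (β a) = TensorProduct.map β β (Δ a)) :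
    IsCocycle (β ∘ₗ μ) (Δ ∘ₗ β) (β ∘ₗ α) := by
  intro a b
  have hμβ : μ ∘ₗ TensorProduct.map β β = β ∘ₗ μ :=
    TensorProduct.ext' fun x y => (hβμ x y).symm
  have hαβ : α ∘ₗ β = β ∘ₗ α := LinearMap.ext fun x => (hβα x).symm
  have left (x : A) (t : A ⊗[k] A) :
      TensorProduct.map μ α ((TensorProduct.assoc k A A A).symm
        (β x ⊗ₜ TensorProduct.map β β t)) =
      TensorProduct.map β β (TensorProduct.map μ α ((TensorProduct.assoc k A A A).symm
        (x ⊗ₜ t))) := by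
    rw [← TensorProduct.map_tmul, ← TensorProduct.map_map_assoc_symm,
      ← LinearMap.comp_apply, ← LinearMap.comp_apply (TensorProduct.map β β),
      ← TensorProduct.map_comp, ← TensorProduct.map_comp, hμβ, hαβ]
  have right (t : A ⊗[k] A) (x : A) :
      TensorProduct.map α μ (TensorProduct.assoc k A A A
        (TensorProduct.map β β t ⊗ₜ β x)) =
      TensorProduct.map β β (TensorProduct.map α μ (TensorProduct.assoc k A A A
        (t ⊗ₜ x))) := by
    rw [← TensorProduct.map_tmul, ← TensorProduct.map_map_assoc,
      ← LinearMap.comp_apply, ← LinearMap.comp_apply (TensorProduct.map β β),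
      ← TensorProduct.map_comp, ← TensorProduct.map_comp, hμβ, hαβ]
  rw [TensorProduct.map_comp, TensorProduct.map_comp]
  simp only [LinearMap.comp_apply, hβΔ, h a b, map_add, left, right]

/-- Twisting an infinitesimal Hom-bialgebra by an endomorphism. -/
theorem IsInfHomBialgebra.twist {μ : A ⊗[k] A →ₗ[k] A} {Δ : A →ₗ[k] A ⊗[k] A}
    {α β : A →ₗ[k] A} (h : IsInfHomBialgebra μ Δ α) (hβα : ∀ x, β (α x) = α (β x))
    (hβμ : ∀ x y, β (μ (x ⊗ₜ y)) = μ (β x ⊗ₜ β y))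
    (hβΔ : ∀ a, Δ (β a) = TensorProduct.map β β (Δ a)) :
    IsInfHomBialgebra (β ∘ₗ μ) (Δ ∘ₗ β) (β ∘ₗ α) :=
  ⟨h.1.twist hβα hβμ, h.2.1.twist hβα hβΔ, h.2.2.twist hβα hβμ hβΔ⟩

theorem IsHomAssociative.pow_mul {μ : A ⊗[k] A →ₗ[k] A} {α : A →ₗ[k] A}
    (h : IsHomAssociative μ α) (m : ℕ) (x y : A) :
    (α ^ m) (μ (x ⊗ₜ y)) = μ ((α ^ m) x ⊗ₜ (α ^ m) y) := by
  induction m with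
  | zero => rfl
  | succ m ih => simp only [pow_succ', Module.End.mul_apply, ih, h.1]

theorem IsHomCoassociative.comul_pow {Δ : A →ₗ[k] A ⊗[k] A} {α : A →ₗ[k] A}
    (h : IsHomCoassociative Δ α) (m : ℕ) (a : A) :
    Δ ((α ^ m) a) = TensorProduct.map (α ^ m) (α ^ m) (Δ a) := by
  induction m with
  | zero => simp [Module.End.one_eq_id]
  | succ m ih =>
    simp only [pow_succ', Module.End.mul_apply, h.1, ih, TensorProduct.map_mul]

/-- the `n`-th derived infinitesimal Hom-bialgebra
`Aⁿ = (A, α^{2ⁿ−1}∘μ, Δ∘α^{2ⁿ−1}, α^{2ⁿ})`. -/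
theorem stmt2 [CharZero k]
    (μ : A ⊗[k] A →ₗ[k] A) (Δ : A →ₗ[k] A ⊗[k] A) (α : A →ₗ[k] A)
    (h : IsInfHomBialgebra μ Δ α) (n : ℕ) :
    IsInfHomBialgebra ((α ^ (2 ^ n - 1)) ∘ₗ μ) (Δ ∘ₗ (α ^ (2 ^ n - 1)))
      (α ^ (2 ^ n)) := by
  have hpow : α ^ (2 ^ n) = (α ^ (2 ^ n - 1)) ∘ₗ α := by
    rw [← Module.End.mul_eq_comp, ← pow_succ, Nat.sub_add_cancel Nat.one_le_two_pow]
  rw [hpow]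
  refine h.twist (fun x => ?_) (h.1.pow_mul _) (h.2.1.comul_pow _)
  rw [← Module.End.mul_apply, ← Module.End.mul_apply, ← pow_succ, ← pow_succ']

end
end

section
/- Let (A, μ, Δ) be an infinitesimal bialgebra and let α : A → A be a morphism of infinitesimal bialgebras, i.e., a linear map satisfying α∘μ = μ∘(α⊗α) and Δ∘α = (α⊗α)∘Δ. Then A_α = (A, μ_α, Δ_α, α) is an infinitesimal Hom-bialgebra, where μ_α = α∘μ and Δ_α = Δ∘α. -/
open TensorProduct

noncomputable section

variable {k : Type*} [Field k] {A : Type*} [AddCommGroup A] [Module k A]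

/-- First Twisting Principle: an infinitesimal bialgebra `(A, μ, Δ)`
together with a morphism `α` of infinitesimal bialgebras yields the infinitesimal
Hom-bialgebra `A_α = (A, α∘μ, Δ∘α, α)`. -/
theorem stmt3 [CharZero k]
    (μ : A ⊗[k] A →ₗ[k] A) (Δ : A →ₗ[k] A ⊗[k] A)
    (h : IsInfHomBialgebra μ Δ (LinearMap.id : A →ₗ[k] A))
    (α : A →ₗ[k] A)
    (hαμ : ∀ x y : A, α (μ (x ⊗ₜ y)) = μ (α x ⊗ₜ α y))
    (hαΔ : ∀ a : A, Δ (α a) = TensorProduct.map α α (Δ a)) :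
    IsInfHomBialgebra (α ∘ₗ μ) (Δ ∘ₗ α) α := by
  obtain ⟨⟨-, assoc⟩, ⟨-, coassoc⟩, cocycle⟩ := h
  refine ⟨⟨fun x y => ?_, fun x y z => ?_⟩, ⟨fun a => hαΔ (α a), fun a => ?_⟩, fun a b => ?_⟩
  · simp only [LinearMap.comp_apply, hαμ]
  · have key := assoc (α x) (α y) (α z)
    simp only [LinearMap.id_apply] at key
    simp only [LinearMap.comp_apply]
    rw [hαμ y z, hαμ x y, key]
  · have hΔ : Δ ∘ₗ α = TensorProduct.map α α ∘ₗ Δ := LinearMap.ext hαΔ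
    have hr : TensorProduct.map α (TensorProduct.map α α ∘ₗ Δ) =
        TensorProduct.map α (TensorProduct.map α α) ∘ₗ TensorProduct.map LinearMap.id Δ := by
      rw [← TensorProduct.map_comp, LinearMap.comp_id]
    have hl : TensorProduct.map (TensorProduct.map α α ∘ₗ Δ) α =
        TensorProduct.map (TensorProduct.map α α) α ∘ₗ TensorProduct.map Δ LinearMap.id := by
      rw [← TensorProduct.map_comp, LinearMap.comp_id]
    have hassoc := LinearMap.congr_fun (TensorProduct.map_map_comp_assoc_eq α α α)
      (TensorProduct.map Δ LinearMap.id (Δ (α a)))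
    simp only [LinearMap.comp_apply, LinearEquiv.coe_coe] at hassoc
    rw [LinearMap.comp_apply, hΔ, hr, hl, LinearMap.comp_apply, LinearMap.comp_apply,
      coassoc, hassoc]
  · have hl : TensorProduct.map (α ∘ₗ μ) α =
        TensorProduct.map α α ∘ₗ TensorProduct.map μ LinearMap.id := by
      rw [← TensorProduct.map_comp, LinearMap.comp_id]
    have hr : TensorProduct.map α (α ∘ₗ μ) =
        TensorProduct.map α α ∘ₗ TensorProduct.map LinearMap.id μ := by
      rw [← TensorProduct.map_comp, LinearMap.comp_id]
    have key := cocycle (α a) (α b)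
    simp only [LinearMap.id_apply] at key
    simp only [hl, hr, LinearMap.comp_apply]
    rw [hαμ a b, hαΔ (μ (α a ⊗ₜ α b)), key, map_add]

end
end

section
/- Let (A, μ, α) be a Hom-associative algebra and let r ∈ A⊗A be an α-invariant 2-tensor. Define Δ : A → A⊗A by Δ(a) = [a,r]_*. Then (A, μ, Δ, α, r) is a coboundary infinitesimal Hom-bialgebra if and only if the 3-tensor A(r) ∈ A⊗A⊗A is A-invariant, i.e., [a, A(r)]_• = 0 for all a ∈ A. -/
open TensorProduct

noncomputable section

variable {k : Type*} [Field k] {A : Type*} [AddCommGroup A] [Module k A]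

/-- The coboundary `[-, r]_*` of an `α`-invariant tensor is comultiplicative. -/
theorem starBracket_comultiplicative {μ : A ⊗[k] A →ₗ[k] A} {α : A →ₗ[k] A} {r : A ⊗[k] A}
    (hA : IsHomAssociative μ α) (hr : TensorProduct.map α α r = r) (a : A) :
    starBracket μ α (α a) r = TensorProduct.map α α (starBracket μ α a r) := by
  suffices h : ∀ s : A ⊗[k] A, starBracket μ α (α a) (TensorProduct.map α α s)
      = TensorProduct.map α α (starBracket μ α a s) by
    simpa only [hr] using h r
  intro s
  induction s with
  | zero => simp
  | add x y hx hy => simp only [map_add, hx, hy]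
  | tmul u v => simp [starBracket, hA.1]

/-- The coboundary `[-, r]_*` of an `α`-invariant tensor satisfies the cocycle condition. -/
theorem starBracket_cocycle {μ : A ⊗[k] A →ₗ[k] A} {α : A →ₗ[k] A} {r : A ⊗[k] A}
    (hA : IsHomAssociative μ α) (hr : TensorProduct.map α α r = r) (a b : A) :
    starBracket μ α (μ (a ⊗ₜ b)) r =
      TensorProduct.map μ α
        ((TensorProduct.assoc k A A A).symm (α a ⊗ₜ starBracket μ α b r)) +
      TensorProduct.map α μ
        (TensorProduct.assoc k A A A (starBracket μ α a r ⊗ₜ α b)) := by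
  suffices h : ∀ s : A ⊗[k] A,
      starBracket μ α (μ (a ⊗ₜ b)) (TensorProduct.map α α s) =
        TensorProduct.map μ α
          ((TensorProduct.assoc k A A A).symm (α a ⊗ₜ starBracket μ α b s)) +
        TensorProduct.map α μ
          (TensorProduct.assoc k A A A (starBracket μ α a s ⊗ₜ α b)) by
    simpa only [hr] using h r
  intro s
  induction s with
  | zero => simp
  | add x y hx hy =>
    simp only [map_add, tmul_add, add_tmul, hx, hy]
    abel
  | tmul u v => simp [starBracket, hA.1, hA.2, tmul_sub, sub_tmul]

/-- The Hom-coassociator of the coboundary `[-, r]_*` of an `α`-invariant tensor `r` is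
`-[a, A(r)]_•`. -/
theorem hom_coassociator_starBracket {μ : A ⊗[k] A →ₗ[k] A} {α : A →ₗ[k] A} {r : A ⊗[k] A}
    (hA : IsHomAssociative μ α) (hr : TensorProduct.map α α r = r)
    {Δ : A →ₗ[k] A ⊗[k] A} (hΔ : ∀ a : A, Δ a = starBracket μ α a r) (a : A) :
    TensorProduct.map α Δ (Δ a) - TensorProduct.assoc k A A A (TensorProduct.map Δ α (Δ a))
      = -dotBracket3 μ α a (Atensor μ α r) := by
  obtain ⟨n, u, v, rfl⟩ := TensorProduct.exists_sum_tmul_eq r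
  have hΔ' (x : A) : Δ x = ∑ j, (μ (x ⊗ₜ α (u j)) ⊗ₜ α (α (v j))
      - α (α (u j)) ⊗ₜ μ (α (v j) ⊗ₜ x)) := by
    rw [hΔ, ← hr]
    simp [starBracket, Finset.sum_sub_distrib]
  have hΔa : Δ a = ∑ i, (μ (a ⊗ₜ u i) ⊗ₜ α (v i) - α (u i) ⊗ₜ μ (v i ⊗ₜ a)) := by
    rw [hΔ]
    simp [starBracket, Finset.sum_sub_distrib]
  rw [hΔa]
  simp only [map_sum, map_sub, map_tmul, hΔ', tmul_sum, sum_tmul, tmul_sub, sub_tmul,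
    assoc_tmul, Atensor, dotBracket3, t13_12, t12_23, t23_13, map_add, LinearMap.comp_apply,
    LinearMap.sub_apply, LinearEquiv.coe_coe, tensorTensorTensorComm_tmul, comm_tmul,
    assoc_symm_tmul, mk_apply, LinearMap.flip_apply, hA.1, hA.2, Finset.sum_sub_distrib]
  rw [Finset.sum_comm (f := fun i j ↦
      μ (μ (a ⊗ₜ u i) ⊗ₜ α (u j)) ⊗ₜ[k] (α (α (v j)) ⊗ₜ[k] α (α (v i)))),
    Finset.sum_comm (f := fun i j ↦
      μ (α (u i) ⊗ₜ α (u j)) ⊗ₜ[k] (α (α (v j)) ⊗ₜ[k] μ (α (v i) ⊗ₜ α a))),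
    Finset.sum_comm (f := fun i j ↦
      μ (α a ⊗ₜ α (u i)) ⊗ₜ[k] (μ (α (v i) ⊗ₜ α (u j)) ⊗ₜ[k] α (α (v j)))),
    Finset.sum_comm (f := fun i j ↦
      α (α (u i)) ⊗ₜ[k] (μ (μ (v i ⊗ₜ a) ⊗ₜ α (u j)) ⊗ₜ[k] α (α (v j))))]
  abel

/-- for a Hom-associative algebra and `α`-invariant `r`, the map
`Δ = [−,r]_*` gives a coboundary infinitesimal Hom-bialgebra iff `A(r)` is
`A`-invariant. -/
theorem stmt7 [CharZero k]
    (μ : A ⊗[k] A →ₗ[k] A) (α : A →ₗ[k] A) (r : A ⊗[k] A)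
    (hA : IsHomAssociative μ α)
    (hr : TensorProduct.map α α r = r)
    (Δ : A →ₗ[k] A ⊗[k] A) (hΔ : ∀ a : A, Δ a = starBracket μ α a r) :
    IsCoboundary μ Δ α r ↔ ∀ a : A, dotBracket3 μ α a (Atensor μ α r) = 0 := by
  have hcoassoc (a : A) := hom_coassociator_starBracket hA hr hΔ a
  constructor
  · rintro ⟨⟨-, ⟨-, h⟩, -⟩, -⟩ a
    rw [← neg_eq_zero, ← hcoassoc, h, sub_self]
  · refine fun h ↦ ⟨⟨hA, ⟨fun a ↦ ?_, fun a ↦ ?_⟩, fun a b ↦ ?_⟩, hr, hΔ⟩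
    · simpa only [hΔ] using starBracket_comultiplicative hA hr a
    · rw [← sub_eq_zero, hcoassoc, h, neg_zero]
    · simpa only [hΔ] using starBracket_cocycle hA hr a b

end
end

section
/- Let (A, μ, α) be a Hom-associative algebra and let r ∈ A⊗A be an α-invariant 2-tensor. Then the map Δ = [−,r]_* : A → A⊗A satisfies the cocycle condition Δ∘μ = (μ⊗α)∘(α⊗Δ) + (α⊗μ)∘(Δ⊗α). -/
open TensorProduct

noncomputable section

variable {k : Type*} [Field k] {A : Type*} [AddCommGroup A] [Module k A]

theorem starBracket_mul_map {μ : A ⊗[k] A →ₗ[k] A} {α : A →ₗ[k] A}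
    (hA : IsHomAssociative μ α) (a b : A) (s : A ⊗[k] A) :
    starBracket μ α (μ (a ⊗ₜ b)) (TensorProduct.map α α s) =
      TensorProduct.map μ α
          ((TensorProduct.assoc k A A A).symm (α a ⊗ₜ starBracket μ α b s)) +
        TensorProduct.map α μ
          (TensorProduct.assoc k A A A (starBracket μ α a s ⊗ₜ α b)) := by
  obtain ⟨hmul, hassoc⟩ := hA
  induction s using TensorProduct.induction_on with
  | zero => simp
  | tmul u v =>
    simp [starBracket, tmul_sub, sub_tmul, hmul, hassoc]
  | add s t hs ht =>
    simp only [map_add, tmul_add, add_tmul, hs, ht]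
    abel

/-- `Δ = [−,r]_*` always satisfies the cocycle condition. -/
theorem stmt8 [CharZero k]
    (μ : A ⊗[k] A →ₗ[k] A) (α : A →ₗ[k] A) (r : A ⊗[k] A)
    (hA : IsHomAssociative μ α)
    (hr : TensorProduct.map α α r = r)
    (Δ : A →ₗ[k] A ⊗[k] A) (hΔ : ∀ a : A, Δ a = starBracket μ α a r) :
    IsCocycle μ Δ α := by
  intro a b
  rw [hΔ, hΔ, hΔ, ← starBracket_mul_map hA, hr]

end
end

section
/- Let (A, μ, α) be a Hom-associative algebra, let r ∈ A⊗A be an α-invariant 2-tensor, and let Δ = [−,r]_* : A → A⊗A. Then for every a ∈ A, ((α⊗Δ)∘Δ)(a) − ((Δ⊗α)∘Δ)(a) = −[a, A(r)]_•. In particular, Δ is Hom-coassociative (i.e., (α⊗Δ)∘Δ = (Δ⊗α)∘Δ) if and only if A(r) is A-invariant. -/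
open TensorProduct

noncomputable section

variable {k : Type*} [Field k] {A : Type*} [AddCommGroup A] [Module k A]

/-- The linear map `a ↦ [a, r]_*`, depending linearly on `r`. -/
def coboundaryMap (μ : A ⊗[k] A →ₗ[k] A) (α : A →ₗ[k] A) :
    A ⊗[k] A →ₗ[k] A →ₗ[k] A ⊗[k] A :=
  LinearMap.mk₂ k (fun r a => starBracket μ α a r)
    (fun r s a => map_add _ r s)
    (fun c r a => map_smul _ c r)
    (fun r a b => by
      simp only [starBracket, map_add, LinearMap.comp_add, TensorProduct.map_add_left,
        TensorProduct.map_add_right, LinearMap.sub_apply, LinearMap.add_apply]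
      abel)
    (fun c r a => by
      simp only [starBracket, map_smul, LinearMap.comp_smul, TensorProduct.map_smul_left,
        TensorProduct.map_smul_right, LinearMap.sub_apply, LinearMap.smul_apply, smul_sub])

lemma coboundaryMap_apply (μ : A ⊗[k] A →ₗ[k] A) (α : A →ₗ[k] A) (r : A ⊗[k] A) (a : A) :
    coboundaryMap μ α r a = starBracket μ α a r := rfl

lemma starBracket_tmul (μ : A ⊗[k] A →ₗ[k] A) (α : A →ₗ[k] A) (a u v : A) :
    starBracket μ α a (u ⊗ₜ v) = μ (a ⊗ₜ u) ⊗ₜ α v - α u ⊗ₜ μ (v ⊗ₜ a) := rfl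

/-- `[a, -]_•` on 3-tensors, left part: `b ↦ Σ μ(α(a),b₁)⊗α(b₂)⊗α(b₃)`. -/
def dotLeft (μ : A ⊗[k] A →ₗ[k] A) (α : A →ₗ[k] A) (a : A) :
    A ⊗[k] (A ⊗[k] A) →ₗ[k] A ⊗[k] (A ⊗[k] A) :=
  TensorProduct.map (μ ∘ₗ TensorProduct.mk k A A (α a)) (TensorProduct.map α α)

/-- `[a, -]_•` on 3-tensors, right part: `b ↦ Σ α(b₁)⊗α(b₂)⊗μ(b₃,α(a))`. -/
def dotRight (μ : A ⊗[k] A →ₗ[k] A) (α : A →ₗ[k] A) (a : A) :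
    A ⊗[k] (A ⊗[k] A) →ₗ[k] A ⊗[k] (A ⊗[k] A) :=
  TensorProduct.map α (TensorProduct.map α (μ ∘ₗ (TensorProduct.mk k A A).flip (α a)))

lemma dotBracket3_eq_sub (μ : A ⊗[k] A →ₗ[k] A) (α : A →ₗ[k] A) (a : A)
    (b : A ⊗[k] (A ⊗[k] A)) :
    dotBracket3 μ α a b = dotLeft μ α a b - dotRight μ α a b := rfl

lemma dotLeft_tmul (μ : A ⊗[k] A →ₗ[k] A) (α : A →ₗ[k] A) (a x y z : A) :
    dotLeft μ α a (x ⊗ₜ (y ⊗ₜ z)) = μ (α a ⊗ₜ x) ⊗ₜ (α y ⊗ₜ α z) := rfl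

lemma dotRight_tmul (μ : A ⊗[k] A →ₗ[k] A) (α : A →ₗ[k] A) (a x y z : A) :
    dotRight μ α a (x ⊗ₜ (y ⊗ₜ z)) = α x ⊗ₜ (α y ⊗ₜ μ (z ⊗ₜ α a)) := rfl

lemma t13_12_tmul (μ : A ⊗[k] A →ₗ[k] A) (α : A →ₗ[k] A) (u v u' v' : A) :
    t13_12 μ α ((u ⊗ₜ v) ⊗ₜ (u' ⊗ₜ v')) = μ (u ⊗ₜ u') ⊗ₜ (α v' ⊗ₜ α v) := rfl

lemma t12_23_tmul (μ : A ⊗[k] A →ₗ[k] A) (α : A →ₗ[k] A) (u v u' v' : A) :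
    t12_23 μ α ((u ⊗ₜ v) ⊗ₜ (u' ⊗ₜ v')) = α u ⊗ₜ (μ (v ⊗ₜ u') ⊗ₜ α v') := rfl

lemma t23_13_tmul (μ : A ⊗[k] A →ₗ[k] A) (α : A →ₗ[k] A) (u v u' v' : A) :
    t23_13 μ α ((u ⊗ₜ v) ⊗ₜ (u' ⊗ₜ v')) = α u' ⊗ₜ (α u ⊗ₜ μ (v ⊗ₜ v')) := rfl

/-- The mixed term `(r, s) ↦ Σ α²(uᵢ)⊗μ(μ(vᵢ,a),α(uⱼ'))⊗α²(vⱼ')`, which occurs in both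
`(α⊗Δ)∘Δ` and `(Δ⊗α)∘Δ`. -/
def mixedTerm (μ : A ⊗[k] A →ₗ[k] A) (α : A →ₗ[k] A) (a : A) :
    (A ⊗[k] A) ⊗[k] (A ⊗[k] A) →ₗ[k] A ⊗[k] (A ⊗[k] A) :=
  TensorProduct.map (α ∘ₗ α)
      (TensorProduct.map
          (μ ∘ₗ TensorProduct.map (μ ∘ₗ (TensorProduct.mk k A A).flip a) α) (α ∘ₗ α)
        ∘ₗ (TensorProduct.assoc k A A A).symm.toLinearMap)
    ∘ₗ (TensorProduct.assoc k A A (A ⊗[k] A)).toLinearMap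

lemma mixedTerm_tmul (μ : A ⊗[k] A →ₗ[k] A) (α : A →ₗ[k] A) (a u v u' v' : A) :
    mixedTerm μ α a ((u ⊗ₜ v) ⊗ₜ (u' ⊗ₜ v'))
      = α (α u) ⊗ₜ (μ (μ (v ⊗ₜ a) ⊗ₜ α u') ⊗ₜ α (α v')) := rfl

lemma map_coboundaryMap_starBracket {μ : A ⊗[k] A →ₗ[k] A} {α : A →ₗ[k] A}
    (hA : IsHomAssociative μ α) (a : A) (r s : A ⊗[k] A) :
    TensorProduct.map α (coboundaryMap μ α (TensorProduct.map α α s)) (starBracket μ α a r)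
      = dotLeft μ α a (t12_23 μ α (r ⊗ₜ s)) - dotLeft μ α a (t23_13 μ α (s ⊗ₜ r))
        - mixedTerm μ α a (r ⊗ₜ s) + dotRight μ α a (t23_13 μ α (s ⊗ₜ r)) := by
  induction r with
  | zero => simp
  | add r₁ r₂ h₁ h₂ =>
    simp only [map_add, TensorProduct.tmul_add, TensorProduct.add_tmul, h₁, h₂]
    abel
  | tmul u v =>
    induction s with
    | zero => simp
    | add s₁ s₂ h₁ h₂ =>
      simp only [map_add, TensorProduct.tmul_add, TensorProduct.add_tmul,
        TensorProduct.map_add_right, LinearMap.add_apply, h₁, h₂]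
      abel
    | tmul u' v' =>
      simp only [starBracket_tmul, map_sub, TensorProduct.map_tmul, coboundaryMap_apply,
        TensorProduct.tmul_sub, t12_23_tmul, t23_13_tmul, dotLeft_tmul, dotRight_tmul,
        mixedTerm_tmul, hA.1, hA.2]
      abel

lemma assoc_map_coboundaryMap_starBracket {μ : A ⊗[k] A →ₗ[k] A} {α : A →ₗ[k] A}
    (hA : IsHomAssociative μ α) (a : A) (r s : A ⊗[k] A) :
    TensorProduct.assoc k A A A
        (TensorProduct.map (coboundaryMap μ α (TensorProduct.map α α s)) α
          (starBracket μ α a r))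
      = dotLeft μ α a (t13_12 μ α (r ⊗ₜ s)) - mixedTerm μ α a (s ⊗ₜ r)
        - dotRight μ α a (t13_12 μ α (r ⊗ₜ s)) + dotRight μ α a (t12_23 μ α (s ⊗ₜ r)) := by
  induction r with
  | zero => simp
  | add r₁ r₂ h₁ h₂ =>
    simp only [map_add, TensorProduct.tmul_add, TensorProduct.add_tmul, h₁, h₂]
    abel
  | tmul u v =>
    induction s with
    | zero => simp
    | add s₁ s₂ h₁ h₂ =>
      simp only [map_add, TensorProduct.tmul_add, TensorProduct.add_tmul,
        TensorProduct.map_add_left, LinearMap.add_apply, h₁, h₂]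
      abel
    | tmul u' v' =>
      simp only [starBracket_tmul, map_sub, TensorProduct.map_tmul, coboundaryMap_apply,
        TensorProduct.sub_tmul, TensorProduct.assoc_tmul, t13_12_tmul, t12_23_tmul,
        dotLeft_tmul, dotRight_tmul, mixedTerm_tmul, hA.1, hA.2]
      abel

/-- `((α⊗Δ)∘Δ − (Δ⊗α)∘Δ)(a) = −[a, A(r)]_•`, so `Δ = [−,r]_*` is
Hom-coassociative iff `A(r)` is `A`-invariant. -/
theorem stmt9 [CharZero k]
    (μ : A ⊗[k] A →ₗ[k] A) (α : A →ₗ[k] A) (r : A ⊗[k] A)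
    (hA : IsHomAssociative μ α)
    (hr : TensorProduct.map α α r = r)
    (Δ : A →ₗ[k] A ⊗[k] A) (hΔ : ∀ a : A, Δ a = starBracket μ α a r) :
    (∀ a : A, TensorProduct.map α Δ (Δ a)
        - TensorProduct.assoc k A A A (TensorProduct.map Δ α (Δ a))
        = - dotBracket3 μ α a (Atensor μ α r)) ∧
    ((∀ a : A, TensorProduct.map α Δ (Δ a)
        = TensorProduct.assoc k A A A (TensorProduct.map Δ α (Δ a)))
      ↔ ∀ a : A, dotBracket3 μ α a (Atensor μ α r) = 0) := by
  have hD : Δ = coboundaryMap μ α (TensorProduct.map α α r) := by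
    ext a
    rw [hr, coboundaryMap_apply, hΔ]
  have key : ∀ a : A, TensorProduct.map α Δ (Δ a)
      - TensorProduct.assoc k A A A (TensorProduct.map Δ α (Δ a))
      = - dotBracket3 μ α a (Atensor μ α r) := by
    intro a
    rw [hΔ a, hD, map_coboundaryMap_starBracket hA, assoc_map_coboundaryMap_starBracket hA,
      dotBracket3_eq_sub, Atensor]
    simp only [map_add, map_sub]
    abel
  refine ⟨key, forall_congr' fun a => ?_⟩
  rw [← sub_eq_zero, key a, neg_eq_zero]
end
end

section
/- Let (A, μ) be an associative algebra, let r ∈ A⊗A be a solution of the associative Yang-Baxter equation (i.e., A(r) = 0 computed with α = Id), and let α : A → A be an algebra morphism. Then for every integer n ≥ 0, the 2-tensor (α⊗α)ⁿ(r) is a solution of the associative Hom-Yang-Baxter equation in the Hom-associative algebra A_α = (A, μ_α, α), where μ_α = α∘μ. -/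
open TensorProduct

noncomputable section

variable {k : Type*} [Field k] {A : Type*} [AddCommGroup A] [Module k A]

/-- Twisting the multiplication by `α` applies `α ⊗ α ⊗ α` to `A(r)`. -/
theorem Atensor_twist (μ : A ⊗[k] A →ₗ[k] A) (α : A →ₗ[k] A) (r : A ⊗[k] A) :
    Atensor (α ∘ₗ μ) α r =
      TensorProduct.map α (TensorProduct.map α α) (Atensor μ LinearMap.id r) := by
  have h₁ : t13_12 (α ∘ₗ μ) α =
      TensorProduct.map α (TensorProduct.map α α) ∘ₗ t13_12 μ LinearMap.id := by
    ext a b c d; simp [t13_12]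
  have h₂ : t12_23 (α ∘ₗ μ) α =
      TensorProduct.map α (TensorProduct.map α α) ∘ₗ t12_23 μ LinearMap.id := by
    ext a b c d; simp [t12_23]
  have h₃ : t23_13 (α ∘ₗ μ) α =
      TensorProduct.map α (TensorProduct.map α α) ∘ₗ t23_13 μ LinearMap.id := by
    ext a b c d; simp [t23_13]
  simp only [Atensor, h₁, h₂, h₃, LinearMap.comp_apply, map_add, map_sub]

/-- `r ↦ A(r)` is natural with respect to multiplicative linear maps. -/
theorem Atensor_map (μ : A ⊗[k] A →ₗ[k] A) (α : A →ₗ[k] A)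
    (hα : ∀ x y : A, α (μ (x ⊗ₜ y)) = μ (α x ⊗ₜ α y)) (r : A ⊗[k] A) :
    Atensor μ LinearMap.id (TensorProduct.map α α r) =
      TensorProduct.map α (TensorProduct.map α α) (Atensor μ LinearMap.id r) := by
  have h₁ : t13_12 μ LinearMap.id ∘ₗ
      TensorProduct.map (TensorProduct.map α α) (TensorProduct.map α α) =
      TensorProduct.map α (TensorProduct.map α α) ∘ₗ t13_12 μ LinearMap.id := by
    ext a b c d; simp [t13_12, hα]
  have h₂ : t12_23 μ LinearMap.id ∘ₗ
      TensorProduct.map (TensorProduct.map α α) (TensorProduct.map α α) =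
      TensorProduct.map α (TensorProduct.map α α) ∘ₗ t12_23 μ LinearMap.id := by
    ext a b c d; simp [t12_23, hα]
  have h₃ : t23_13 μ LinearMap.id ∘ₗ
      TensorProduct.map (TensorProduct.map α α) (TensorProduct.map α α) =
      TensorProduct.map α (TensorProduct.map α α) ∘ₗ t23_13 μ LinearMap.id := by
    ext a b c d; simp [t23_13, hα]
  have e₁ := LinearMap.congr_fun h₁ (r ⊗ₜ r)
  have e₂ := LinearMap.congr_fun h₂ (r ⊗ₜ r)
  have e₃ := LinearMap.congr_fun h₃ (r ⊗ₜ r)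
  simp only [LinearMap.comp_apply, TensorProduct.map_tmul] at e₁ e₂ e₃
  simp only [Atensor, e₁, e₂, e₃, map_add, map_sub]

/-- a solution of the AYBE twisted by an algebra morphism gives
solutions `(α⊗α)ⁿ(r)` of the AHYBE in `A_α = (A, α∘μ, α)`. -/
theorem stmt11 [CharZero k]
    (μ : A ⊗[k] A →ₗ[k] A)
    (hassoc : ∀ x y z : A, μ (μ (x ⊗ₜ y) ⊗ₜ z) = μ (x ⊗ₜ μ (y ⊗ₜ z)))
    (r : A ⊗[k] A)
    (hr : Atensor μ (LinearMap.id : A →ₗ[k] A) r = 0)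
    (α : A →ₗ[k] A)
    (hα : ∀ x y : A, α (μ (x ⊗ₜ y)) = μ (α x ⊗ₜ α y)) :
    ∀ n : ℕ, Atensor (α ∘ₗ μ) α ((TensorProduct.map α α ^ n) r) = 0 := by
  intro n
  have key : Atensor μ LinearMap.id ((TensorProduct.map α α ^ n) r) = 0 := by
    induction n with
    | zero => simpa using hr
    | succ n ih => rw [pow_succ', Module.End.mul_apply, Atensor_map μ α hα, ih, map_zero]
  rw [Atensor_twist, key, map_zero]

end
end

section
/- Let (A, μ, α) be a Hom-associative algebra and let r ∈ A⊗A be a solution of the associative Hom-Yang-Baxter equation in A. Then for every integer n ≥ 0, r is also a solution of the associative Hom-Yang-Baxter equation in the Hom-associative algebra Aⁿ = (A, μ⁽ⁿ⁾, α^{2ⁿ}), where μ⁽ⁿ⁾ = α^{2ⁿ−1}∘μ. -/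
open TensorProduct

noncomputable section

variable {k : Type*} [Field k] {A : Type*} [AddCommGroup A] [Module k A]

/-- Post-composing both structure maps with a linear map `β` applies `β` to every leg of `A(r)`. -/
theorem Atensor_comp (μ : A ⊗[k] A →ₗ[k] A) (α β : A →ₗ[k] A) (r : A ⊗[k] A) :
    Atensor (β ∘ₗ μ) (β ∘ₗ α) r
      = TensorProduct.map β (TensorProduct.map β β) (Atensor μ α r) := by
  have h₁ : t13_12 (β ∘ₗ μ) (β ∘ₗ α)
      = TensorProduct.map β (TensorProduct.map β β) ∘ₗ t13_12 μ α := by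
    ext; simp [t13_12]
  have h₂ : t12_23 (β ∘ₗ μ) (β ∘ₗ α)
      = TensorProduct.map β (TensorProduct.map β β) ∘ₗ t12_23 μ α := by
    ext; simp [t12_23]
  have h₃ : t23_13 (β ∘ₗ μ) (β ∘ₗ α)
      = TensorProduct.map β (TensorProduct.map β β) ∘ₗ t23_13 μ α := by
    ext; simp [t23_13]
  simp [Atensor, h₁, h₂, h₃]

/-- a solution of the AHYBE remains a solution in each derived
Hom-associative algebra `Aⁿ = (A, α^{2ⁿ−1}∘μ, α^{2ⁿ})`. -/
theorem stmt12 [CharZero k]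
    (μ : A ⊗[k] A →ₗ[k] A) (α : A →ₗ[k] A) (r : A ⊗[k] A)
    (hA : IsHomAssociative μ α)
    (hr : Atensor μ α r = 0) :
    ∀ n : ℕ, Atensor ((α ^ (2 ^ n - 1)) ∘ₗ μ) (α ^ (2 ^ n)) r = 0 := by
  intro n
  have hα : α ^ (2 ^ n) = (α ^ (2 ^ n - 1)) ∘ₗ α := by
    rw [← Module.End.mul_eq_comp, ← pow_succ, Nat.sub_add_cancel Nat.one_le_two_pow]
  rw [hα, Atensor_comp, hr, map_zero]

end
end
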